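/- Any finite sequence over an alphabet of n symbols in which no two consecutive symbols are equal and which contains no (not necessarily consecutive) alternating subsequence a, b, a, b, a of length 5 for distinct symbols a, b, has length at most 2n·ln n + 3n (for n ≥ 2). -/

import Mathlib

/-- Two lists without equal neighbours can be concatenated, at the cost of at most one symbol,
into a list without equal neighbours. -/
theorem List.exists_isChain_ne_sublist_append {α : Type*} (l₁ l₂ : List α)
    (h₁ : l₁.IsChain (· ≠ ·)) (h₂ : l₂.IsChain (· ≠ ·)) :
    ∃ l : List α, l.IsChain (· ≠ ·) ∧ l.Sublist (l₁ ++ l₂) ∧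
      l₁.length + l₂.length ≤ l.length + 1 := by
  by_cases h : ∀ x ∈ l₁.getLast?, ∀ y ∈ l₂.head?, x ≠ y
  · exact ⟨l₁ ++ l₂, List.isChain_append.2 ⟨h₁, h₂, h⟩, List.Sublist.refl _, by simp⟩
  · push Not at h
    obtain ⟨x, hx, y, hy, rfl⟩ := h
    refine ⟨l₁ ++ l₂.tail, List.isChain_append.2 ⟨h₁, h₂.tail, ?_⟩,
      (List.tail_sublist l₂).append_left l₁, by simp; omega⟩
    intro x' hx' y' hy'
    obtain rfl : x' = x := Option.mem_unique hx' hx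
    cases l₂ with
    | nil => simp at hy
    | cons z t =>
      simp only [List.head?_cons, Option.mem_def, Option.some.injEq] at hy
      subst hy
      cases t with
      | nil => simp at hy'
      | cons w t =>
        simp only [List.tail_cons, List.head?_cons, Option.mem_def, Option.some.injEq] at hy'
        subst hy'
        exact (List.isChain_cons_cons.1 h₂).1

/-- Erasing a symbol `x` from a list without equal neighbours creates no equal neighbours,
provided that `x` never lies between two occurrences of another symbol. -/
theorem List.IsChain.filter_ne_of_forall_not_sublist {α : Type*} [DecidableEq α] {x : α}
    {l : List α} (h : l.IsChain (· ≠ ·)) (hx : ∀ a, a ≠ x → ¬ [a, x, a].Sublist l) :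
    (l.filter (· ≠ x)).IsChain (· ≠ ·) := by
  induction l with
  | nil => simp
  | cons a t ih =>
    have ih' := ih h.tail fun b hb hs => hx b hb (hs.cons a)
    by_cases hax : a = x
    · simpa [hax] using ih'
    · rw [List.filter_cons_of_pos (by simpa using hax), List.isChain_cons]
      refine ⟨?_, ih'⟩
      rintro y hy rfl
      cases t with
      | nil => simp at hy
      | cons b t =>
        have hab : a ≠ b := (List.isChain_cons_cons.1 h).1
        by_cases hbx : b = x
        · subst hbx
          have hmem : a ∈ (b :: t).filter (· ≠ b) := List.mem_of_mem_head? hy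
          have hat : a ∈ t := by
            simp only [List.mem_filter, List.mem_cons] at hmem
            tauto
          exact hx a hax (((List.singleton_sublist.2 hat).cons_cons b).cons_cons a)
        · rw [List.filter_cons_of_pos (by simpa using hbx)] at hy
          simp only [List.head?_cons, Option.mem_def, Option.some.injEq] at hy
          exact hab hy.symm

/-- A list without equal neighbours and without alternations of length five between
distinct symbols. -/
def IsDavenportSchinzelThree {α : Type*} (l : List α) : Prop :=
  l.IsChain (· ≠ ·) ∧ ∀ a b, a ≠ b → ¬ [a, b, a, b, a].Sublist l

theorem List.exists_eq_append_cons_of_mem_last {α : Type*} {x : α} {l : List α} (h : x ∈ l) :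
    ∃ s t, l = s ++ x :: t ∧ x ∉ t := by
  obtain ⟨s, t, hst, hs⟩ := List.eq_append_cons_of_mem (List.mem_reverse.2 h)
  refine ⟨t.reverse, s.reverse, ?_, by simpa using hs⟩
  simpa using congrArg List.reverse hst

/-- Removing all occurrences of a symbol `x`, and at most two further entries, from a
Davenport–Schinzel sequence of order three leaves a Davenport–Schinzel sequence. -/
theorem IsDavenportSchinzelThree.exists_sublist_filter_ne {α : Type*} [DecidableEq α]
    {l : List α} (h : IsDavenportSchinzelThree l) (x : α) :
    ∃ l' : List α, IsDavenportSchinzelThree l' ∧ l'.Sublist (l.filter (· ≠ x)) ∧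
      l.length ≤ l'.length + l.count x + 2 := by
  have key : ∃ l' : List α, l'.IsChain (· ≠ ·) ∧ l'.Sublist (l.filter (· ≠ x)) ∧
      (l.filter (· ≠ x)).length ≤ l'.length + 2 := by
    have hself : ∀ s : List α, x ∉ s → s.filter (· ≠ x) = s := fun s hs =>
      List.filter_eq_self.2 fun a ha => by
        simpa using fun e : a = x => hs (e ▸ ha)
    obtain ⟨hc, halt⟩ := h
    by_cases hx : x ∈ l
    · obtain ⟨s, t, rfl, hs⟩ := List.eq_append_cons_of_mem hx
      have hcs := hc.left_of_append
      have hct := hc.right_of_append.tail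
      simp only [List.tail_cons] at hct
      by_cases hxt : x ∈ t
      · obtain ⟨b, c, rfl, hcx⟩ := List.exists_eq_append_cons_of_mem_last hxt
        have hcb := hct.left_of_append
        have hcc := hct.right_of_append.tail
        simp only [List.tail_cons] at hcc
        have hfb := hcb.filter_ne_of_forall_not_sublist (x := x) fun a ha hab => by
          refine halt x a (Ne.symm ha) ?_
          have h1 : [x].Sublist (x :: c) := by simp
          exact (((hab.append h1).cons_cons x).trans (List.sublist_append_right s _))
        obtain ⟨p, hp, hps, hpl⟩ := List.exists_isChain_ne_sublist_append _ _ hcs hfb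
        obtain ⟨q, hq, hqs, hql⟩ := List.exists_isChain_ne_sublist_append _ _ hp hcc
        have e : (s ++ x :: (b ++ x :: c)).filter (· ≠ x) = s ++ b.filter (· ≠ x) ++ c := by
          rw [List.filter_append, List.filter_cons_of_neg (by simp), List.filter_append,
            List.filter_cons_of_neg (by simp), hself s hs, hself c hcx, List.append_assoc]
        rw [e]
        refine ⟨q, hq, hqs.trans (hps.append_right c), ?_⟩
        simp only [List.length_append]
        omega
      · obtain ⟨p, hp, hps, hpl⟩ := List.exists_isChain_ne_sublist_append _ _ hcs hct
        have e : (s ++ x :: t).filter (· ≠ x) = s ++ t := by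
          rw [List.filter_append, List.filter_cons_of_neg (by simp), hself s hs, hself t hxt]
        rw [e]
        refine ⟨p, hp, hps, ?_⟩
        simp only [List.length_append]
        omega
    · rw [hself l hx]
      exact ⟨l, hc, List.Sublist.refl _, by omega⟩
  obtain ⟨l', hc', hsub, hlen⟩ := key
  refine ⟨l', ⟨hc', fun a b hab hs => h.2 a b hab ?_⟩, hsub, ?_⟩
  · exact hs.trans (hsub.trans List.filter_sublist)
  · have h1 : l.length = l.count x + (l.filter (· ≠ x)).length := by
      rw [← List.countP_eq_length_filter, List.count,
        List.length_eq_countP_add_countP (fun a => a == x)]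
      congr 2
      funext a
      simp
    omega

/-- Some symbol of a nonempty list occurs at most as often as the average symbol. -/
theorem List.exists_mem_card_mul_count_le_length {α : Type*} [DecidableEq α] {l : List α}
    (hl : l ≠ []) : ∃ x ∈ l, l.toFinset.card * l.count x ≤ l.length := by
  by_contra! hcon
  have hne : l.toFinset.Nonempty := List.toFinset_nonempty_iff l |>.2 hl
  have hlt : ∑ _x ∈ l.toFinset, l.length < ∑ x ∈ l.toFinset, l.toFinset.card * l.count x :=
    Finset.sum_lt_sum_of_nonempty hne fun x hx => hcon x (List.mem_toFinset.1 hx)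
  rw [← Finset.mul_sum, List.sum_toFinset_count_eq_length, Finset.sum_const, smul_eq_mul] at hlt
  exact lt_irrefl _ hlt

theorem IsDavenportSchinzelThree.length_le_harmonic {α : Type*} [DecidableEq α] (n : ℕ)
    (l : List α) (h : IsDavenportSchinzelThree l) (hcard : l.toFinset.card ≤ n + 1) :
    (l.length : ℚ) ≤ (n + 1) * (1 + 2 * harmonic n) := by
  induction n generalizing l with
  | zero =>
    match l, h, hcard with
    | [], _, _ => simp
    | [a], _, _ => simp
    | a :: b :: t, h, hcard =>
      exact absurd (Finset.card_le_one.1 hcard a (by simp) b (by simp))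
        (List.isChain_cons_cons.1 h.1).1
  | succ n ih =>
    have hstep : harmonic (n + 1) = harmonic n + ((n : ℚ) + 1)⁻¹ := by
      rw [harmonic_succ]; push_cast; rfl
    have hH : 0 ≤ harmonic n := Finset.sum_nonneg fun i _ => by positivity
    have hn : (0 : ℚ) < (n : ℚ) + 1 := by positivity
    have hinv : 0 < ((n : ℚ) + 1)⁻¹ := by positivity
    by_cases hc : l.toFinset.card ≤ n + 1
    · refine (ih l h hc).trans ?_
      rw [hstep]
      push_cast
      gcongr <;> linarith
    · have hcard' : l.toFinset.card = n + 2 := by omega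
      have hl : l ≠ [] := by rintro rfl; simp at hcard'
      obtain ⟨x, hx, hcount⟩ := List.exists_mem_card_mul_count_le_length hl
      obtain ⟨l', h', hsub, hlen⟩ := h.exists_sublist_filter_ne x
      have hsubset : l'.toFinset ⊆ l.toFinset.erase x := fun y hy => by
        have := hsub.subset (List.mem_toFinset.1 hy)
        simpa [and_comm] using this
      have hle := Finset.card_le_card hsubset
      rw [Finset.card_erase_of_mem (List.mem_toFinset.2 hx), hcard'] at hle
      have hih := ih l' h' (by omega)
      rw [hcard'] at hcount
      have hcountQ : ((n : ℚ) + 2) * l.count x ≤ l.length := by exact_mod_cast hcount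
      have hlenQ : (l.length : ℚ) ≤ l'.length + l.count x + 2 := by exact_mod_cast hlen
      have hprod : ((n : ℚ) + 1) * l.length ≤
          (n + 2) * ((n + 1) * (1 + 2 * harmonic n) + 2) := by
        have hmul : ((n : ℚ) + 2) * l.length ≤
            (n + 2) * ((n + 1) * (1 + 2 * harmonic n) + l.count x + 2) := by
          gcongr
          linarith
        linarith
      rw [hstep]
      push_cast
      refine le_of_mul_le_mul_left (hprod.trans_eq ?_) hn
      field_simp
      ring

theorem davenport_schinzel_order_three (n m : ℕ) (hn : 2 ≤ n)
    (u : Fin m → Fin n)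
    (hconsec : ∀ (i : ℕ) (h : i + 1 < m),
      u ⟨i, Nat.lt_of_succ_lt h⟩ ≠ u ⟨i + 1, h⟩)
    (halt : ¬ ∃ (a b : Fin n) (i1 i2 i3 i4 i5 : Fin m),
      a ≠ b ∧ i1 < i2 ∧ i2 < i3 ∧ i3 < i4 ∧ i4 < i5 ∧
      u i1 = a ∧ u i2 = b ∧ u i3 = a ∧ u i4 = b ∧ u i5 = a) :
    (m : ℝ) ≤ 2 * n * Real.log n + 3 * n := by
  have hds : IsDavenportSchinzelThree (List.ofFn u) := by
    refine ⟨?_, fun a b hab hs => halt ?_⟩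
    · rw [List.isChain_iff_getElem]
      intro i hi
      simpa using hconsec i (by simpa using hi)
    · obtain ⟨f, hf⟩ := List.sublist_iff_exists_fin_orderEmbedding_get_eq.1 hs
      have hlt : ∀ i j : Fin 5, i < j →
          Fin.cast (List.length_ofFn (f := u)) (f i) <
            Fin.cast (List.length_ofFn (f := u)) (f j) :=
        fun i j hij => f.strictMono hij
      have hu : ∀ i : Fin 5, u (Fin.cast (List.length_ofFn (f := u)) (f i)) =
          [a, b, a, b, a].get i := fun i => by
        rw [hf i, List.get_ofFn]
      exact ⟨a, b, _, _, _, _, _, hab, hlt 0 1 (by decide), hlt 1 2 (by decide),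
        hlt 2 3 (by decide), hlt 3 4 (by decide), hu 0, hu 1, hu 2, hu 3, hu 4⟩
  obtain ⟨k, rfl⟩ : ∃ k, n = k + 1 := ⟨n - 1, by omega⟩
  have hcard : (List.ofFn u).toFinset.card ≤ k + 1 := by
    simpa using Finset.card_le_univ (List.ofFn u).toFinset
  have hbound := hds.length_le_harmonic k _ hcard
  rw [List.length_ofFn] at hbound
  have hboundR : (m : ℝ) ≤ (k + 1) * (1 + 2 * (harmonic k : ℝ)) := by exact_mod_cast hbound
  have hlog : (harmonic k : ℝ) ≤ 1 + Real.log ((k + 1 : ℕ) : ℝ) := by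
    refine (harmonic_le_one_add_log k).trans ?_
    have hk : (0 : ℝ) < k := by exact_mod_cast (by omega : 0 < k)
    gcongr
    omega
  calc (m : ℝ) ≤ (k + 1) * (1 + 2 * (harmonic k : ℝ)) := hboundR
    _ ≤ (k + 1) * (1 + 2 * (1 + Real.log ((k + 1 : ℕ) : ℝ))) := by gcongr
    _ = 2 * ((k + 1 : ℕ) : ℝ) * Real.log ((k + 1 : ℕ) : ℝ) + 3 * ((k + 1 : ℕ) : ℝ) := by
      push_cast
      ring
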